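/- Let (J^ℱ,(f_n)) and (J^𝒢,(g_n)) be two unimodal nonautonomous discrete dynamical systems with the same kneading sequence, and assume that 𝒞_n(ℱ) is dense in J^ℱ and 𝒞_n(𝒢) is dense in J^𝒢 for all n≥1. Then there exists a sequence (h_n)_{n≥1} of order-preserving homeomorphisms h_n:J^ℱ→J^𝒢 such that h_{n+1}∘f_n=g_n∘h_n for each n≥1. -/

import Mathlib

open Set

noncomputable section

/-- The nonautonomous iterate `f_n^ℓ = f_{n+ℓ-1} ∘ ⋯ ∘ f_n` (and `f_n^0 = id`). -/
def iterFrom (f : ℕ → ℝ → ℝ) : ℕ → ℕ → ℝ → ℝ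
  | _, 0, x => x
  | n, ℓ + 1, x => f (n + ℓ) (iterFrom f n ℓ x)

/-- `(Icc a b, (f n))` is a unimodal nonautonomous discrete dynamical system with
turning points `c n`. -/
def IsUNDS (a b : ℝ) (f : ℕ → ℝ → ℝ) (c : ℕ → ℝ) : Prop :=
  a < b ∧ ∀ n : ℕ,
    ContinuousOn (f n) (Icc a b) ∧
    MapsTo (f n) (Icc a b) (Icc a b) ∧
    f n a = a ∧ f n b = a ∧
    c n ∈ Ioo a b ∧
    StrictMonoOn (f n) (Icc a (c n)) ∧
    StrictAntiOn (f n) (Icc (c n) b)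

/-- The two systems have the same kneading sequence (`𝕍(ℱ) = 𝕍(𝒢)`). -/
def SameKneading (f : ℕ → ℝ → ℝ) (cF : ℕ → ℝ) (g : ℕ → ℝ → ℝ) (cG : ℕ → ℝ) : Prop :=
  ∀ n ℓ : ℕ,
    (iterFrom f n ℓ (cF n) < cF (n + ℓ) ↔ iterFrom g n ℓ (cG n) < cG (n + ℓ)) ∧
    (iterFrom f n ℓ (cF n) = cF (n + ℓ) ↔ iterFrom g n ℓ (cG n) = cG (n + ℓ))

/-- `𝒞_n(ℱ)`: points of `Icc a b` eventually mapped onto a turning point. -/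
def critSet (a b : ℝ) (f : ℕ → ℝ → ℝ) (c : ℕ → ℝ) (n : ℕ) : Set ℝ :=
  {x ∈ Icc a b | ∃ ℓ : ℕ, iterFrom f n ℓ x = c (n + ℓ)}


/-- The points `x` and `y` have the same itinerary from time `n` on, under `f` and `g`. -/
def SameItinerary (f : ℕ → ℝ → ℝ) (cF : ℕ → ℝ) (g : ℕ → ℝ → ℝ) (cG : ℕ → ℝ)
    (n : ℕ) (x y : ℝ) : Prop :=
  ∀ ℓ : ℕ,
    (iterFrom f n ℓ x < cF (n + ℓ) ↔ iterFrom g n ℓ y < cG (n + ℓ)) ∧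
    (iterFrom f n ℓ x = cF (n + ℓ) ↔ iterFrom g n ℓ y = cG (n + ℓ))

theorem iterFrom_succ' (f : ℕ → ℝ → ℝ) (n ℓ : ℕ) (x : ℝ) :
    iterFrom f n (ℓ + 1) x = iterFrom f (n + 1) ℓ (f n x) := by
  induction ℓ with
  | zero => rfl
  | succ k ih =>
    change f (n + (k + 1)) (iterFrom f n (k + 1) x) = f (n + 1 + k) _
    rw [ih, show n + (k + 1) = n + 1 + k by omega]

namespace SameItinerary

variable {f g : ℕ → ℝ → ℝ} {cF cG : ℕ → ℝ} {n : ℕ} {x y : ℝ}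

theorem symm (h : SameItinerary f cF g cG n x y) : SameItinerary g cG f cF n y x :=
  fun ℓ => ⟨(h ℓ).1.symm, (h ℓ).2.symm⟩

theorem lt_iff (h : SameItinerary f cF g cG n x y) : x < cF n ↔ y < cG n := (h 0).1

theorem eq_iff (h : SameItinerary f cF g cG n x y) : x = cF n ↔ y = cG n := (h 0).2

theorem le_iff (h : SameItinerary f cF g cG n x y) : x ≤ cF n ↔ y ≤ cG n := by
  rw [le_iff_lt_or_eq, le_iff_lt_or_eq, h.lt_iff, h.eq_iff]

theorem gt_iff (h : SameItinerary f cF g cG n x y) : cF n < x ↔ cG n < y := by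
  rw [← not_le, ← not_le, h.le_iff]

theorem ge_iff (h : SameItinerary f cF g cG n x y) : cF n ≤ x ↔ cG n ≤ y := by
  rw [← not_lt, ← not_lt, h.lt_iff]

theorem step (h : SameItinerary f cF g cG n x y) :
    SameItinerary f cF g cG (n + 1) (f n x) (g n y) := by
  intro ℓ
  have := h (ℓ + 1)
  rwa [iterFrom_succ', iterFrom_succ', show n + (ℓ + 1) = n + 1 + ℓ by omega] at this

theorem of_step (h : SameItinerary f cF g cG (n + 1) (f n x) (g n y))
    (hlt : x < cF n ↔ y < cG n) (heq : x = cF n ↔ y = cG n) :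
    SameItinerary f cF g cG n x y := by
  rintro (_ | ℓ)
  · exact ⟨hlt, heq⟩
  · rw [iterFrom_succ', iterFrom_succ', show n + (ℓ + 1) = n + 1 + ℓ by omega]
    exact h ℓ

end SameItinerary

theorem SameKneading.symm {f g : ℕ → ℝ → ℝ} {cF cG : ℕ → ℝ}
    (h : SameKneading f cF g cG) : SameKneading g cG f cF :=
  fun n ℓ => ⟨(h n ℓ).1.symm, (h n ℓ).2.symm⟩

theorem SameKneading.sameItinerary {f g : ℕ → ℝ → ℝ} {cF cG : ℕ → ℝ}
    (h : SameKneading f cF g cG) (n : ℕ) : SameItinerary f cF g cG n (cF n) (cG n) :=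
  h n

namespace IsUNDS

variable {a b : ℝ} {f : ℕ → ℝ → ℝ} {c : ℕ → ℝ}

theorem mapsTo (h : IsUNDS a b f c) (n : ℕ) : MapsTo (f n) (Icc a b) (Icc a b) := (h.2 n).2.1

theorem mem_Ioo (h : IsUNDS a b f c) (n : ℕ) : c n ∈ Ioo a b := (h.2 n).2.2.2.2.1

theorem lt_of_le_turning (h : IsUNDS a b f c) {n : ℕ} {x y : ℝ} (hx : a ≤ x) (hxy : x < y)
    (hy : y ≤ c n) : f n x < f n y :=
  (h.2 n).2.2.2.2.2.1 ⟨hx, hxy.le.trans hy⟩ ⟨hx.trans hxy.le, hy⟩ hxy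

theorem lt_of_turning_le (h : IsUNDS a b f c) {n : ℕ} {x y : ℝ} (hx : c n ≤ x) (hxy : x < y)
    (hy : y ≤ b) : f n y < f n x :=
  (h.2 n).2.2.2.2.2.2 ⟨hx, hxy.le.trans hy⟩ ⟨hx.trans hxy.le, hy⟩ hxy

theorem le_of_le_turning (h : IsUNDS a b f c) {n : ℕ} {x y : ℝ} (hx : a ≤ x) (hxy : x ≤ y)
    (hy : y ≤ c n) : f n x ≤ f n y := by
  rcases hxy.eq_or_lt with rfl | hlt
  exacts [le_rfl, (h.lt_of_le_turning hx hlt hy).le]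

theorem le_of_turning_le (h : IsUNDS a b f c) {n : ℕ} {x y : ℝ} (hx : c n ≤ x) (hxy : x ≤ y)
    (hy : y ≤ b) : f n y ≤ f n x := by
  rcases hxy.eq_or_lt with rfl | hlt
  exacts [le_rfl, (h.lt_of_turning_le hx hlt hy).le]

theorem lt_turning_value (h : IsUNDS a b f c) {n : ℕ} {x : ℝ} (hx : x ∈ Icc a b)
    (hne : x ≠ c n) : f n x < f n (c n) := by
  rcases hne.lt_or_gt with hlt | hlt
  exacts [h.lt_of_le_turning hx.1 hlt le_rfl, h.lt_of_turning_le le_rfl hlt hx.2]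

theorem iterFrom_mem (h : IsUNDS a b f c) (n ℓ : ℕ) {x : ℝ} (hx : x ∈ Icc a b) :
    iterFrom f n ℓ x ∈ Icc a b := by
  induction ℓ with
  | zero => exact hx
  | succ k ih => exact h.mapsTo _ ih

theorem continuousOn_iterFrom (h : IsUNDS a b f c) (n ℓ : ℕ) :
    ContinuousOn (iterFrom f n ℓ) (Icc a b) := by
  induction ℓ with
  | zero => exact continuousOn_id
  | succ k ih => exact (h.2 (n + k)).1.comp ih fun x hx => h.iterFrom_mem n k hx

theorem iterFrom_left (h : IsUNDS a b f c) (n ℓ : ℕ) : iterFrom f n ℓ a = a := by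
  induction ℓ with
  | zero => rfl
  | succ k ih =>
    change f (n + k) (iterFrom f n k a) = a
    rw [ih, (h.2 _).2.2.1]

theorem exists_left_preimage (h : IsUNDS a b f c) {n : ℕ} {y : ℝ} (hy : a ≤ y)
    (hlt : y < f n (c n)) : ∃ x ∈ Icc a b, x < c n ∧ f n x = y := by
  have hc := h.mem_Ioo n
  obtain ⟨x, hx, rfl⟩ := intermediate_value_Icc hc.1.le
    ((h.2 n).1.mono (Icc_subset_Icc_right hc.2.le)) ⟨(h.2 n).2.2.1.trans_le hy, hlt.le⟩
  refine ⟨x, ⟨hx.1, hx.2.trans hc.2.le⟩, lt_of_le_of_ne hx.2 ?_, rfl⟩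
  rintro rfl
  exact hlt.false

theorem exists_right_preimage (h : IsUNDS a b f c) {n : ℕ} {y : ℝ} (hy : a ≤ y)
    (hlt : y < f n (c n)) : ∃ x ∈ Icc a b, c n < x ∧ f n x = y := by
  have hc := h.mem_Ioo n
  obtain ⟨x, hx, rfl⟩ := intermediate_value_Icc' hc.2.le
    ((h.2 n).1.mono (Icc_subset_Icc_left hc.1.le)) ⟨(h.2 n).2.2.2.1.trans_le hy, hlt.le⟩
  refine ⟨x, ⟨hc.1.le.trans hx.1, hx.2⟩, lt_of_le_of_ne hx.1 ?_, rfl⟩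
  rintro rfl
  exact hlt.false

end IsUNDS

theorem exists_critSet_between {a b : ℝ} {f : ℕ → ℝ → ℝ} {c : ℕ → ℝ} {n : ℕ}
    (hdense : Icc a b ⊆ closure (critSet a b f c n)) {x y : ℝ} (hx : a ≤ x) (hxy : x < y)
    (hy : y ≤ b) : ∃ z ∈ critSet a b f c n, x < z ∧ z < y := by
  have hm : (x + y) / 2 ∈ Icc a b := ⟨by linarith, by linarith⟩
  obtain ⟨z, hz, hzc⟩ := mem_closure_iff.1 (hdense hm) (Ioo x y) isOpen_Ioo
    ⟨by linarith, by linarith⟩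
  exact ⟨z, hzc, hz.1, hz.2⟩

section Realization

variable {aF bF aG bG : ℝ} {f g : ℕ → ℝ → ℝ} {cF cG : ℕ → ℝ}

theorem SameItinerary.lt_of_separated (hF : IsUNDS aF bF f cF) (hG : IsUNDS aG bG g cG)
    (ℓ : ℕ) {n : ℕ} {x x' y y' z : ℝ} (hx : x ∈ Icc aF bF) (hx' : x' ∈ Icc aF bF)
    (hy : y ∈ Icc aG bG) (hy' : y' ∈ Icc aG bG)
    (h : SameItinerary f cF g cG n x y) (h' : SameItinerary f cF g cG n x' y')
    (hxz : x < z) (hzx : z < x') (hz : iterFrom f n ℓ z = cF (n + ℓ)) : y < y' := by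
  induction ℓ generalizing n x x' y y' z with
  | zero =>
    have hz : z = cF n := hz
    subst hz
    exact (h.lt_iff.1 hxz).trans (h'.gt_iff.1 hzx)
  | succ k ih =>
    rw [iterFrom_succ', show n + (k + 1) = n + 1 + k by omega] at hz
    rcases le_or_gt (cF n) x with hc | hc
    · have hlt : g n y' < g n y := ih (hF.mapsTo n hx') (hF.mapsTo n hx) (hG.mapsTo n hy')
        (hG.mapsTo n hy) h'.step h.step (hF.lt_of_turning_le (hc.trans hxz.le) hzx hx'.2)
        (hF.lt_of_turning_le hc hxz (hzx.le.trans hx'.2)) hz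
      by_contra! hle
      exact hlt.not_ge
        (hG.le_of_turning_le (h'.ge_iff.1 (hc.trans (hxz.trans hzx).le)) hle hy.2)
    · rcases le_or_gt x' (cF n) with hc' | hc'
      · have hlt : g n y < g n y' := ih (hF.mapsTo n hx) (hF.mapsTo n hx') (hG.mapsTo n hy)
          (hG.mapsTo n hy') h.step h'.step (hF.lt_of_le_turning hx.1 hxz (hzx.le.trans hc'))
          (hF.lt_of_le_turning (hx.1.trans hxz.le) hzx hc') hz
        by_contra! hle
        exact hlt.not_ge (hG.le_of_le_turning hy'.1 hle (h.le_iff.1 hc.le))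
      · exact (h.lt_iff.1 hc).trans (h'.gt_iff.1 hc')

theorem SameItinerary.lt_of_lt (hF : IsUNDS aF bF f cF) (hG : IsUNDS aG bG g cG)
    (hdense : ∀ n, Icc aF bF ⊆ closure (critSet aF bF f cF n))
    {n : ℕ} {x x' y y' : ℝ} (hx : x ∈ Icc aF bF) (hx' : x' ∈ Icc aF bF)
    (hy : y ∈ Icc aG bG) (hy' : y' ∈ Icc aG bG)
    (h : SameItinerary f cF g cG n x y) (h' : SameItinerary f cF g cG n x' y')
    (hlt : x < x') : y < y' := by
  obtain ⟨z, ⟨-, ℓ, hz⟩, hxz, hzx⟩ := exists_critSet_between (hdense n) hx.1 hlt hx'.2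
  exact lt_of_separated hF hG ℓ hx hx' hy hy' h h' hxz hzx hz

theorem SameItinerary.eq_of_eq (hF : IsUNDS aF bF f cF) (hG : IsUNDS aG bG g cG)
    (hdense : ∀ n, Icc aG bG ⊆ closure (critSet aG bG g cG n))
    {n : ℕ} {x y y' : ℝ} (hx : x ∈ Icc aF bF) (hy : y ∈ Icc aG bG) (hy' : y' ∈ Icc aG bG)
    (h : SameItinerary f cF g cG n x y) (h' : SameItinerary f cF g cG n x y') : y = y' := by
  rcases lt_trichotomy y y' with hlt | heq | hlt
  · exact (lt_irrefl x (lt_of_lt hG hF hdense hy hy' hx hx h.symm h'.symm hlt)).elim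
  · exact heq
  · exact (lt_irrefl x (lt_of_lt hG hF hdense hy' hy hx hx h'.symm h.symm hlt)).elim

theorem exists_sameItinerary_of_mem_critSet (hF : IsUNDS aF bF f cF) (hG : IsUNDS aG bG g cG)
    (hknead : SameKneading f cF g cG)
    (hdense : ∀ n, Icc aF bF ⊆ closure (critSet aF bF f cF n))
    {n : ℕ} {x : ℝ} (hx : x ∈ critSet aF bF f cF n) :
    ∃ y ∈ Icc aG bG, SameItinerary f cF g cG n x y := by
  obtain ⟨hx, ℓ, hℓ⟩ := hx
  have turning (n : ℕ) : ∃ y ∈ Icc aG bG, SameItinerary f cF g cG n (cF n) y :=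
    ⟨cG n, Ioo_subset_Icc_self (hG.mem_Ioo n), hknead.sameItinerary n⟩
  induction ℓ generalizing n x with
  | zero =>
    have hℓ : x = cF n := hℓ
    exact hℓ ▸ turning n
  | succ k ih =>
    by_cases hne : x = cF n
    · exact hne ▸ turning n
    rw [iterFrom_succ', show n + (k + 1) = n + 1 + k by omega] at hℓ
    obtain ⟨y', hy', hyy⟩ := ih (hF.mapsTo n hx) hℓ
    have hcF := Ioo_subset_Icc_self (hF.mem_Ioo n)
    have hcG := Ioo_subset_Icc_self (hG.mem_Ioo n)
    have hlt : y' < g n (cG n) := SameItinerary.lt_of_lt hF hG hdense (hF.mapsTo n hx)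
      (hF.mapsTo n hcF) hy' (hG.mapsTo n hcG) hyy (hknead.sameItinerary n).step
      (hF.lt_turning_value hx hne)
    rcases lt_or_gt_of_ne hne with hxc | hxc
    · obtain ⟨y, hy, hyc, rfl⟩ := hG.exists_left_preimage hy'.1 hlt
      exact ⟨y, hy, hyy.of_step (iff_of_true hxc hyc) (iff_of_false hne hyc.ne)⟩
    · obtain ⟨y, hy, hyc, rfl⟩ := hG.exists_right_preimage hy'.1 hlt
      exact ⟨y, hy, hyy.of_step (iff_of_false hxc.not_gt hyc.not_gt)
        (iff_of_false hne hyc.ne')⟩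

theorem sign_eq_of_between (hG : IsUNDS aG bG g cG) (hF : IsUNDS aF bF f cF) (k : ℕ)
    {n : ℕ} {z x z' u y u' : ℝ}
    (hz : z ∈ Icc aF bF) (hx : x ∈ Icc aF bF) (hz' : z' ∈ Icc aF bF)
    (hu : u ∈ Icc aG bG) (hy : y ∈ Icc aG bG) (hu' : u' ∈ Icc aG bG)
    (h : SameItinerary f cF g cG n z u) (h' : SameItinerary f cF g cG n z' u')
    (huy : u ≤ y) (hyu : y ≤ u')
    (hsign : ∀ j ≤ k,
      (iterFrom f n j z < cF (n + j) ∧ iterFrom f n j x < cF (n + j) ∧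
        iterFrom f n j z' < cF (n + j)) ∨
      (cF (n + j) < iterFrom f n j z ∧ cF (n + j) < iterFrom f n j x ∧
        cF (n + j) < iterFrom f n j z')) :
    (iterFrom f n k x < cF (n + k) ↔ iterFrom g n k y < cG (n + k)) ∧
    (iterFrom f n k x = cF (n + k) ↔ iterFrom g n k y = cG (n + k)) := by
  induction k generalizing n z x z' u y u' with
  | zero =>
    rcases hsign 0 le_rfl with ⟨-, hxc, hzc⟩ | ⟨hzc, hxc, -⟩
    · have hyc : y < cG n := hyu.trans_lt (h'.lt_iff.1 hzc)
      exact ⟨iff_of_true hxc hyc, iff_of_false hxc.ne hyc.ne⟩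
    · have hyc : cG n < y := (h.gt_iff.1 hzc).trans_le huy
      exact ⟨iff_of_false hxc.not_gt hyc.not_gt, iff_of_false hxc.ne' hyc.ne'⟩
  | succ k ih =>
    rw [iterFrom_succ', iterFrom_succ', show n + (k + 1) = n + 1 + k by omega]
    have hstep : ∀ j ≤ k,
        (iterFrom f (n + 1) j (f n z) < cF (n + 1 + j) ∧
          iterFrom f (n + 1) j (f n x) < cF (n + 1 + j) ∧
          iterFrom f (n + 1) j (f n z') < cF (n + 1 + j)) ∨
        (cF (n + 1 + j) < iterFrom f (n + 1) j (f n z) ∧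
          cF (n + 1 + j) < iterFrom f (n + 1) j (f n x) ∧
          cF (n + 1 + j) < iterFrom f (n + 1) j (f n z')) := by
      intro j hj
      have := hsign (j + 1) (by omega)
      rwa [iterFrom_succ', iterFrom_succ', iterFrom_succ',
        show n + (j + 1) = n + 1 + j by omega] at this
    rcases hsign 0 (Nat.zero_le _) with ⟨-, -, hzc⟩ | ⟨hzc, -, -⟩
    · have huc : u' < cG n := h'.lt_iff.1 hzc
      exact ih (hF.mapsTo n hz) (hF.mapsTo n hx) (hF.mapsTo n hz') (hG.mapsTo n hu)
        (hG.mapsTo n hy) (hG.mapsTo n hu') h.step h'.step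
        (hG.le_of_le_turning hu.1 huy (hyu.trans huc.le))
        (hG.le_of_le_turning hy.1 hyu huc.le) hstep
    · have huc : cG n < u := h.gt_iff.1 hzc
      refine ih (hF.mapsTo n hz') (hF.mapsTo n hx) (hF.mapsTo n hz) (hG.mapsTo n hu')
        (hG.mapsTo n hy) (hG.mapsTo n hu) h'.step h.step
        (hG.le_of_turning_le (huc.le.trans huy) hyu hu'.2)
        (hG.le_of_turning_le huc.le huy hy.2) fun j hj => ?_
      rcases hstep j hj with ⟨h1, h2, h3⟩ | ⟨h1, h2, h3⟩
      exacts [Or.inl ⟨h3, h2, h1⟩, Or.inr ⟨h3, h2, h1⟩]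

theorem sameItinerary_left (hF : IsUNDS aF bF f cF) (hG : IsUNDS aG bG g cG) (n : ℕ) :
    SameItinerary f cF g cG n aF aG := by
  intro ℓ
  rw [hF.iterFrom_left, hG.iterFrom_left]
  have h1 := (hF.mem_Ioo (n + ℓ)).1
  have h2 := (hG.mem_Ioo (n + ℓ)).1
  exact ⟨iff_of_true h1 h2, iff_of_false h1.ne h2.ne⟩

theorem sameItinerary_right (hF : IsUNDS aF bF f cF) (hG : IsUNDS aG bG g cG) (n : ℕ) :
    SameItinerary f cF g cG n bF bG := by
  have h1 := (hF.mem_Ioo n).2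
  have h2 := (hG.mem_Ioo n).2
  refine SameItinerary.of_step ?_ (iff_of_false h1.not_gt h2.not_gt)
    (iff_of_false h1.ne' h2.ne')
  rw [(hF.2 n).2.2.2.1, (hG.2 n).2.2.2.1]
  exact sameItinerary_left hF hG (n + 1)

theorem exists_pos_forall_sign_eq (hF : IsUNDS aF bF f cF) {n : ℕ} {x : ℝ}
    (hx : x ∈ Icc aF bF) (hne : ∀ ℓ, iterFrom f n ℓ x ≠ cF (n + ℓ)) (k : ℕ) :
    ∃ ε > 0, ∀ z ∈ Icc aF bF, |z - x| < ε → ∀ j ≤ k,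
      (iterFrom f n j z < cF (n + j) ∧ iterFrom f n j x < cF (n + j)) ∨
      (cF (n + j) < iterFrom f n j z ∧ cF (n + j) < iterFrom f n j x) := by
  have hev : ∀ᶠ z in nhdsWithin x (Icc aF bF), ∀ j ∈ Iic k,
      (iterFrom f n j z < cF (n + j) ∧ iterFrom f n j x < cF (n + j)) ∨
      (cF (n + j) < iterFrom f n j z ∧ cF (n + j) < iterFrom f n j x) := by
    refine (Filter.eventually_all_finite (finite_Iic k)).2 fun j _ => ?_
    have hcont := hF.continuousOn_iterFrom n j x hx
    rcases (hne j).lt_or_gt with hlt | hlt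
    · filter_upwards [hcont.eventually_lt_const hlt] with z hz using Or.inl ⟨hz, hlt⟩
    · filter_upwards [hcont.eventually_const_lt hlt] with z hz using Or.inr ⟨hz, hlt⟩
  obtain ⟨ε, hε, hball⟩ := Metric.mem_nhdsWithin_iff.1 hev
  exact ⟨ε, hε, fun z hz hzx => hball ⟨by rwa [Metric.mem_ball, Real.dist_eq], hz⟩⟩

theorem exists_sameItinerary (hF : IsUNDS aF bF f cF) (hG : IsUNDS aG bG g cG)
    (hknead : SameKneading f cF g cG)
    (hdense : ∀ n, Icc aF bF ⊆ closure (critSet aF bF f cF n))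
    (n : ℕ) {x : ℝ} (hx : x ∈ Icc aF bF) :
    ∃ y ∈ Icc aG bG, SameItinerary f cF g cG n x y := by
  by_cases hcrit : x ∈ critSet aF bF f cF n
  · exact exists_sameItinerary_of_mem_critSet hF hG hknead hdense hcrit
  have hne (ℓ : ℕ) : iterFrom f n ℓ x ≠ cF (n + ℓ) := fun h => hcrit ⟨hx, ℓ, h⟩
  rcases hx.1.eq_or_lt with rfl | hax
  · exact ⟨aG, left_mem_Icc.2 hG.1.le, sameItinerary_left hF hG n⟩
  rcases hx.2.eq_or_lt with rfl | hxb
  · exact ⟨bG, right_mem_Icc.2 hG.1.le, sameItinerary_right hF hG n⟩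
  set S : Set ℝ := {u | u ∈ Icc aG bG ∧ ∃ z ∈ critSet aF bF f cF n,
    z < x ∧ SameItinerary f cF g cG n z u} with hS
  have hbdd : BddAbove S := ⟨bG, fun u hu => hu.1.2⟩
  have hSne : S.Nonempty := by
    obtain ⟨z, hz, -, hzx⟩ := exists_critSet_between (hdense n) le_rfl hax hx.2
    obtain ⟨u, hu, hzu⟩ := exists_sameItinerary_of_mem_critSet hF hG hknead hdense hz
    exact ⟨u, hu, z, hz, hzx, hzu⟩
  have hy : sSup S ∈ Icc aG bG := by
    obtain ⟨u, hu⟩ := hSne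
    exact ⟨hu.1.1.trans (le_csSup hbdd hu), csSup_le ⟨u, hu⟩ fun v hv => hv.1.2⟩
  refine ⟨sSup S, hy, fun k => ?_⟩
  obtain ⟨ε, hε, hsign⟩ := exists_pos_forall_sign_eq hF hx hne k
  obtain ⟨z, hz, hzl, hzx⟩ := exists_critSet_between (hdense n) (le_max_left aF (x - ε))
    (max_lt hax (sub_lt_self x hε)) hx.2
  obtain ⟨z', hz', hxz', hzr⟩ := exists_critSet_between (hdense n) hx.1
    (lt_min hxb (lt_add_of_pos_right x hε)) (min_le_left bF (x + ε))
  obtain ⟨u, hu, hzu⟩ := exists_sameItinerary_of_mem_critSet hF hG hknead hdense hz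
  obtain ⟨u', hu', hzu'⟩ := exists_sameItinerary_of_mem_critSet hF hG hknead hdense hz'
  have hzε : |z - x| < ε := by
    have := (max_lt_iff.1 hzl).2
    rw [abs_lt]; constructor <;> linarith
  have hzε' : |z' - x| < ε := by
    have := (lt_min_iff.1 hzr).2
    rw [abs_lt]; constructor <;> linarith
  refine sign_eq_of_between hG hF k hz.1 hx hz'.1 hu hy hu' hzu hzu'
    (le_csSup hbdd ⟨hu, z, hz, hzx, hzu⟩) (csSup_le hSne ?_) fun j hj => ?_
  · rintro v ⟨hv, w, hw, hwx, hwv⟩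
    exact (SameItinerary.lt_of_lt hF hG hdense hw.1 hz'.1 hv hu' hwv hzu'
      (hwx.trans hxz')).le
  · rcases hsign z hz.1 hzε j hj with ⟨h1, h2⟩ | ⟨h1, h2⟩ <;>
      rcases hsign z' hz'.1 hzε' j hj with ⟨h3, h4⟩ | ⟨h3, h4⟩
    · exact Or.inl ⟨h1, h2, h3⟩
    · exact (h2.not_gt h4).elim
    · exact (h2.not_gt h4).elim
    · exact Or.inr ⟨h1, h2, h3⟩

end Realization

/-- If two UNDS have the same kneading sequence and both critical sets `𝒞_n(ℱ)`,
`𝒞_n(𝒢)` are dense in the respective intervals for all `n`, then there is a sequence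
of order-preserving homeomorphisms `h n : J^ℱ → J^𝒢` with `h (n+1) ∘ f n = g n ∘ h n`. -/
theorem exists_conjugating_homeos_of_sameKneading_of_dense
    (aF bF aG bG : ℝ) (f g : ℕ → ℝ → ℝ) (cF cG : ℕ → ℝ)
    (hF : IsUNDS aF bF f cF) (hG : IsUNDS aG bG g cG)
    (hknead : SameKneading f cF g cG)
    (hdenseF : ∀ n : ℕ, Icc aF bF ⊆ closure (critSet aF bF f cF n))
    (hdenseG : ∀ n : ℕ, Icc aG bG ⊆ closure (critSet aG bG g cG n)) :
    ∃ h : ℕ → ℝ → ℝ,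
      (∀ n, StrictMonoOn (h n) (Icc aF bF)) ∧
      (∀ n, ContinuousOn (h n) (Icc aF bF)) ∧
      (∀ n, BijOn (h n) (Icc aF bF) (Icc aG bG)) ∧
      (∀ n, ∀ x ∈ Icc aF bF, h (n + 1) (f n x) = g n (h n x)) := by
  have hex (n : ℕ) (x : ℝ) : ∃ y, x ∈ Icc aF bF →
      y ∈ Icc aG bG ∧ SameItinerary f cF g cG n x y := by
    by_cases hx : x ∈ Icc aF bF
    · obtain ⟨y, hy⟩ := exists_sameItinerary hF hG hknead hdenseF n hx
      exact ⟨y, fun _ => hy⟩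
    · exact ⟨0, fun h => (hx h).elim⟩
  choose h hh using hex
  have hmaps (n : ℕ) : MapsTo (h n) (Icc aF bF) (Icc aG bG) := fun x hx => (hh n x hx).1
  have hmono (n : ℕ) : StrictMonoOn (h n) (Icc aF bF) := fun x hx x' hx' hlt =>
    SameItinerary.lt_of_lt hF hG hdenseF hx hx' (hmaps n hx) (hmaps n hx')
      (hh n x hx).2 (hh n x' hx').2 hlt
  have hsurj (n : ℕ) : SurjOn (h n) (Icc aF bF) (Icc aG bG) := by
    intro y hy
    obtain ⟨x, hx, hyx⟩ := exists_sameItinerary hG hF hknead.symm hdenseG n hy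
    exact ⟨x, hx, SameItinerary.eq_of_eq hF hG hdenseG hx (hmaps n hx) hy (hh n x hx).2
      hyx.symm⟩
  refine ⟨h, hmono, fun n => ?_, fun n => ⟨hmaps n, (hmono n).injOn, hsurj n⟩,
    fun n x hx => ?_⟩
  · have hcont : Continuous ((hmaps n).restrict (h n) _ _) :=
      Monotone.continuous_of_surjective (fun x x' hle => (hmono n).monotoneOn x.2 x'.2 hle)
        ((hmaps n).restrict_surjective_iff.2 (hsurj n))
    exact continuousOn_iff_continuous_domRestrict.2 (continuous_subtype_val.comp hcont)
  · exact SameItinerary.eq_of_eq hF hG hdenseG (hF.mapsTo n hx)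
      (hmaps (n + 1) (hF.mapsTo n hx)) (hG.mapsTo n (hmaps n hx))
      (hh (n + 1) _ (hF.mapsTo n hx)).2 (hh n x hx).2.step
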